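/- Let P be a finite poc set, let U_1, …, U_k be ultrafilters on P, and let n_1, …, n_k ∈ ℕ satisfy n_i + n_j ≥ d∞(U_i, U_j) for all i, j ∈ {1,…,k}. Then there exists an ultrafilter V on P with d∞(V, U_i) ≤ n_i for all i; that is, the set of ultrafilters on P with the distance d∞ is hyperconvex for integer radii. -/

import Mathlib

/-- A *poc set*: a poset with least element `⊥` and an order-reversing involution
`pstar` such that `a ≤ pstar a → a = ⊥`. -/
class PocSet (P : Type) extends PartialOrder P, OrderBot P where
  pstar : P → P
  pstar_pstar : ∀ a : P, pstar (pstar a) = a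
  pstar_antitone : ∀ {a b : P}, a ≤ b → pstar b ≤ pstar a
  eq_bot_of_le_pstar : ∀ a : P, a ≤ pstar a → a = ⊥

namespace PocSet

variable {P : Type} [PocSet P]

/-- An *ultrafilter* on a poc set: a complete `⋆`-selection (for every `a`, exactly
one of `a`, `a⋆` belongs) which is coherent (no `a, b ∈ U` satisfy `a ≤ b⋆`). -/
def IsUltra (U : Set P) : Prop :=
  (∀ a : P, a ∈ U ↔ pstar a ∉ U) ∧ ∀ a ∈ U, ∀ b ∈ U, ¬ a ≤ pstar b

/-- Two elements are *nested* if one of the four nesting relations holds. -/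
def Nested (a b : P) : Prop :=
  a ≤ b ∨ a ≤ pstar b ∨ pstar a ≤ b ∨ pstar a ≤ pstar b

/-- A set is *nested* if its elements are pairwise nested. -/
def NestedSet (N : Set P) : Prop := ∀ a ∈ N, ∀ b ∈ N, Nested a b

/-- A set is *transverse* if no two distinct elements of it are nested. -/
def Transverse (A : Set P) : Prop := ∀ a ∈ A, ∀ b ∈ A, a ≠ b → ¬ Nested a b

/-- The set of minimal elements of `V` (w.r.t. the order induced from `P`). -/
def minset (V : Set P) : Set P := {a ∈ V | ∀ b ∈ V, b ≤ a → b = a}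

/-- An element is *proper* if it is neither `0` nor `0⋆`. -/
def IsProper (a : P) : Prop := a ≠ ⊥ ∧ a ≠ pstar (⊥ : P)

/-- `d∞(U,W)`: the maximum cardinality of a nested subset of `U \ W`. -/
noncomputable def dinfty (U W : Set P) : ℕ :=
  sSup {n : ℕ | ∃ N : Set P, N ⊆ U \ W ∧ NestedSet N ∧ N.ncard = n}

/-- The `ℓ¹`-distance between ultrafilters on a finite poc set: `|U \ W|`. -/
noncomputable def ellone (U W : Set P) : ℕ := (U \ W).ncard

end PocSet

open PocSet

namespace PocSet

variable {P : Type} [PocSet P]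

/-- A subset of a poc set is *coherent* if it contains no `a, b` with `a ≤ b⋆`. -/
def Coherent (F : Set P) : Prop := ∀ a ∈ F, ∀ b ∈ F, ¬ a ≤ pstar b

/-- `a` lies below a chain of at least `m` elements, none of which belongs to `U`. -/
def HasChainAbove (U : Set P) (m : ℕ) (a : P) : Prop :=
  ∃ C : Set P, IsChain (· ≤ ·) C ∧ m ≤ C.ncard ∧ ∀ c ∈ C, a ≤ c ∧ c ∉ U

theorem pstar_injective : Function.Injective (pstar : P → P) :=
  Function.LeftInverse.injective pstar_pstar

theorem le_pstar_comm {a b : P} : a ≤ pstar b ↔ b ≤ pstar a :=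
  ⟨fun h => by simpa [pstar_pstar] using pstar_antitone h,
    fun h => by simpa [pstar_pstar] using pstar_antitone h⟩

theorem IsUltra.pstar_mem {U : Set P} (hU : IsUltra U) {a : P} (ha : a ∉ U) : pstar a ∈ U :=
  not_not.1 (mt (hU.1 a).2 ha)

theorem IsUltra.mem_of_le {U : Set P} (hU : IsUltra U) {a b : P} (ha : a ∈ U) (hab : a ≤ b) :
    b ∈ U := by
  by_contra hb
  exact hU.2 a ha _ (hU.pstar_mem hb) (by rwa [pstar_pstar])

/-- Inside `U \ W`, nestedness means comparability. -/
theorem isChain_of_nestedSet {U W N : Set P} (hU : IsUltra U) (hW : IsUltra W)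
    (hN : N ⊆ U \ W) (h : NestedSet N) : IsChain (· ≤ ·) N := by
  intro a ha b hb _
  rcases h a ha b hb with h | h | h | h
  · exact Or.inl h
  · exact absurd h (hU.2 a (hN ha).1 b (hN hb).1)
  · exact absurd (hW.mem_of_le (hW.pstar_mem (hN ha).2) h) (hN hb).2
  · exact Or.inr (by simpa [pstar_pstar] using pstar_antitone h)

theorem nestedSet_of_isChain {N : Set P} (h : IsChain (· ≤ ·) N) : NestedSet N := by
  intro a ha b hb
  rcases h.total ha hb with h | h
  · exact Or.inl h
  · exact Or.inr (Or.inr (Or.inr (pstar_antitone h)))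

theorem ncard_le_dinfty [Finite P] {U W N : Set P} (hN : N ⊆ U \ W)
    (h : IsChain (· ≤ ·) N) : N.ncard ≤ dinfty U W := by
  refine le_csSup ⟨Nat.card P, ?_⟩ ⟨N, hN, nestedSet_of_isChain h, rfl⟩
  rintro m ⟨M, -, -, rfl⟩
  exact Set.ncard_le_card M

/-- An ultrafilter avoiding every element with a long chain above
it outside `U` lies in the corresponding `d∞`-ball around `U`. -/
theorem dinfty_le_of_forall_hasChainAbove [Finite P] {U V : Set P} (hU : IsUltra U)
    (hV : IsUltra V) {m : ℕ} (h : ∀ a, HasChainAbove U (m + 1) a → a ∉ V) :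
    dinfty V U ≤ m := by
  refine csSup_le' ?_
  rintro _ ⟨N, hN, hnest, rfl⟩
  by_contra! hlt
  have hchain := isChain_of_nestedSet hV hU hN hnest
  obtain ⟨a, ha⟩ := N.toFinite.exists_minimal (Set.nonempty_of_ncard_ne_zero (by omega))
  refine h a ⟨N, hchain, hlt, fun c hc => ⟨?_, (hN hc).2⟩⟩ (hN ha.prop).1
  rcases hchain.total ha.prop hc with h | h
  · exact h
  · exact ha.le_of_le hc h

/-- Chains above `a` and `b`, where `a⋆ ≤ b`, concatenate to a chain in `U \ W`. -/
theorem add_le_dinfty_of_hasChainAbove [Finite P] {U W : Set P} (hU : IsUltra U)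
    (hW : IsUltra W) {m n : ℕ} {a b : P} (ha : HasChainAbove U (m + 1) a)
    (hb : HasChainAbove W (n + 1) b) (hab : pstar a ≤ b) : m + n + 1 ≤ dinfty U W := by
  obtain ⟨C, hC, hCm, hCa⟩ := ha
  obtain ⟨D, hD, hDn, hDb⟩ := hb
  have hle : ∀ c ∈ C, ∀ d ∈ D, pstar c ≤ d := fun c hc d hd =>
    ((pstar_antitone (hCa c hc).1).trans hab).trans (hDb d hd).1
  obtain ⟨c₀, hc₀⟩ : C.Nonempty := Set.nonempty_of_ncard_ne_zero (by omega)
  obtain ⟨d₀, hd₀⟩ : D.Nonempty := Set.nonempty_of_ncard_ne_zero (by omega)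
  have hsub : pstar '' C ∪ D ⊆ U \ W := by
    rintro _ (⟨c, hc, rfl⟩ | hd)
    · exact ⟨hU.pstar_mem (hCa c hc).2,
        fun h => (hDb d₀ hd₀).2 (hW.mem_of_le h (hle c hc d₀ hd₀))⟩
    · exact ⟨hU.mem_of_le (hU.pstar_mem (hCa c₀ hc₀).2) (hle c₀ hc₀ _ hd), (hDb _ hd).2⟩
  have hchain : IsChain (· ≤ ·) (pstar '' C ∪ D) := by
    rintro _ (⟨c, hc, rfl⟩ | hx) _ (⟨d, hd, rfl⟩ | hy) hne
    · exact (hC.total hc hd).symm.imp pstar_antitone pstar_antitone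
    · exact Or.inl (hle c hc _ hy)
    · exact Or.inr (hle d hd _ hx)
    · exact hD hx hy hne
  have hinter : (pstar '' C ∩ D).ncard ≤ 1 := by
    refine (Set.ncard_le_ncard (t := {b}) ?_).trans (Set.ncard_singleton b).le
    rintro _ ⟨⟨c, hc, rfl⟩, hd⟩
    exact le_antisymm ((pstar_antitone (hCa c hc).1).trans hab) (hDb _ hd).1
  have hcard := Set.ncard_union_add_ncard_inter (pstar '' C) D
  rw [Set.ncard_image_of_injective C pstar_injective] at hcard
  have := ncard_le_dinfty hsub hchain
  omega

theorem bot_notMem_of_coherent {F : Set P} (hF : Coherent F) : (⊥ : P) ∉ F :=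
  fun h => hF ⊥ h ⊥ h bot_le

/-- If a coherent set cannot be enlarged by `a`, then `a = ⊥` or some element of it is `≤ a⋆`. -/
theorem eq_bot_or_exists_le_pstar_of_not_coherent_insert {M : Set P} (hM : Coherent M) {a : P}
    (h : ¬ Coherent (insert a M)) : a = ⊥ ∨ ∃ m ∈ M, m ≤ pstar a := by
  unfold Coherent at h
  push Not at h
  obtain ⟨x, rfl | hx, y, rfl | hy, hxy⟩ := h
  · exact Or.inl (eq_bot_of_le_pstar _ hxy)
  · exact Or.inr ⟨y, hy, le_pstar_comm.1 hxy⟩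
  · exact Or.inr ⟨x, hx, hxy⟩
  · exact absurd hxy (hM x hx y hy)

/-- In a finite nontrivial poc set, every coherent set extends to an ultrafilter. -/
theorem exists_isUltra_of_coherent [Finite P] (hbot : pstar (⊥ : P) ≠ ⊥) {F : Set P}
    (hF : Coherent F) : ∃ V : Set P, IsUltra V ∧ F ⊆ V := by
  obtain ⟨M, hFM, hM⟩ := (Set.toFinite {M : Set P | Coherent M}).exists_le_maximal hF
  have hcoh : Coherent M := hM.prop
  have hins : ∀ a ∉ M, a = ⊥ ∨ ∃ m ∈ M, m ≤ pstar a := fun a ha =>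
    eq_bot_or_exists_le_pstar_of_not_coherent_insert hcoh fun h =>
      ha (hM.le_of_ge h (Set.subset_insert a M) (Set.mem_insert a M))
  have hM0 := bot_notMem_of_coherent hcoh
  refine ⟨M, ⟨fun a => ⟨fun ha ha' => hcoh a ha _ ha' (pstar_pstar a).ge, fun ha' => ?_⟩, hcoh⟩,
    hFM⟩
  by_contra ha
  have key := hins _ ha'
  rw [pstar_pstar] at key
  rcases hins a ha with rfl | ⟨m, hm, hma⟩
  · rcases key with h | ⟨m, hm, hma⟩
    · exact hbot h
    · exact hM0 (le_bot_iff.1 hma ▸ hm)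
  · rcases key with h | ⟨m', hm', hma'⟩
    · exact hM0 (le_bot_iff.1 (h ▸ hma) ▸ hm)
    · exact hcoh m hm m' hm' (hma.trans (pstar_antitone hma'))

end PocSet

/-- The set of ultrafilters on a finite poc set, with the distance `d∞`, is
hyperconvex for integer radii: if `n i + n j ≥ d∞(U i, U j)` for all `i, j`, then
some ultrafilter `V` satisfies `d∞(V, U i) ≤ n i` for all `i`. -/
theorem dinfty_hyperconvex_integer_radii {P : Type} [PocSet P] [Finite P]
    (k : ℕ) (hk : 0 < k) (U : Fin k → Set P) (hU : ∀ i, IsUltra (U i))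
    (n : Fin k → ℕ) (hn : ∀ i j, dinfty (U i) (U j) ≤ n i + n j) :
    ∃ V : Set P, IsUltra V ∧ ∀ i, dinfty V (U i) ≤ n i := by
  have hbot : pstar (⊥ : P) ≠ ⊥ := fun h => by
    have := (hU ⟨0, hk⟩).1 ⊥
    rw [h] at this
    exact iff_not_self this
  obtain ⟨V, hV, hFV⟩ := exists_isUltra_of_coherent hbot
    (F := {a | ∃ i, HasChainAbove (U i) (n i + 1) (pstar a)}) (by
      rintro a ⟨i, hi⟩ b ⟨j, hj⟩ hab
      have := add_le_dinfty_of_hasChainAbove (hU i) (hU j) hi hj (by rwa [pstar_pstar])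
      have := hn i j
      omega)
  refine ⟨V, hV, fun i => dinfty_le_of_forall_hasChainAbove (hU i) hV fun a ha haV => ?_⟩
  exact (hV.1 a).1 haV (hFV ⟨i, by rwa [pstar_pstar]⟩)
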